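/- For each r ∈ {1, 2, 3} there exist finite simple graphs G_r and H_r such that w⁽ʳ⁾(G_r) = w⁽ʳ⁾(H_r) but w⁽ʳ⁺¹⁾(G_r) ≠ w⁽ʳ⁺¹⁾(H_r); that is, the hierarchy of invariants w⁽¹⁾ ⪯ w⁽²⁾ ⪯ w⁽³⁾ ⪯ w⁽⁴⁾ is strict. -/

import Mathlib

/-- The walk count `w_k(x,y)`: the number of walks of length `k` from `x` to `y`,
i.e. the `(x,y)` entry of the `k`-th power of the adjacency matrix. -/
def walkFun {V : Type*} [Fintype V] [DecidableEq V]
    (G : SimpleGraph V) [DecidableRel G.Adj] (x y : V) : ℕ → ℕ :=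
  fun k => (G.adjMatrix ℕ ^ k) x y

/-- The type of the walk-refinement color of a vertex after `r` rounds. -/
def WT : ℕ → Type
  | 0 => ℕ → ℕ
  | r + 1 => WT r × Multiset ((ℕ → ℕ) × WT r)

/-- The walk-refinement coloring: `ω_0(x) = (k ↦ w_k(x,x))` and
`ω_{r+1}(x) = (ω_r(x), ⦃((k ↦ w_k(x,y)), ω_r(y)) : y ∈ V⦄)`. -/
def omegaC {V : Type*} [Fintype V] [DecidableEq V]
    (G : SimpleGraph V) [DecidableRel G.Adj] : (r : ℕ) → V → WT r
  | 0, x => walkFun G x x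
  | r + 1, x =>
    (omegaC G r x,
      (Finset.univ : Finset V).val.map fun y => (walkFun G x y, omegaC G r y))

/-- `w⁽ʳ⁾(G)`: the multiset, over vertices `x`, of `ω_r(x)`. -/
def wR {V : Type*} [Fintype V] [DecidableEq V]
    (G : SimpleGraph V) [DecidableRel G.Adj] (r : ℕ) : Multiset (WT r) :=
  (Finset.univ : Finset V).val.map (omegaC G r)

/-! ### Evaluation helpers -/

/-- The `i`-th digit of `N` in base `2 ^ b`. -/
def digW (b N i : ℕ) : ℕ := Nat.mod (Nat.shiftRight N (Nat.mul b i)) (Nat.pow 2 b)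

/-- Bounded universal quantifier. -/
def allW (n : ℕ) (f : ℕ → Bool) : Bool := Nat.rec true (fun k ih => f k && ih) n

/-- Bounded sum. -/
def sumW (n : ℕ) (f : ℕ → ℕ) : ℕ := Nat.rec 0 (fun k ih => ih + f k) n

theorem allW_iff (n : ℕ) (f : ℕ → Bool) : allW n f = true ↔ ∀ k < n, f k = true := by
  induction n with
  | zero => simp [allW]
  | succ n ih =>
    have : allW (n + 1) f = (f n && allW n f) := rfl
    rw [this, Bool.and_eq_true, ih, Nat.forall_lt_succ_right, and_comm]

theorem beqW_iff (a b : ℕ) : Nat.beq a b = true ↔ a = b :=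
  ⟨Nat.eq_of_beq_eq_true, fun h => h ▸ Nat.beq_refl a⟩

theorem bltW_iff (a b : ℕ) : Nat.blt a b = true ↔ a < b := by
  simp [Nat.blt_eq]

theorem sumW_eq (n : ℕ) (f : ℕ → ℕ) : sumW n f = ∑ k ∈ Finset.range n, f k := by
  induction n with
  | zero => simp [sumW]
  | succ n ih =>
    have : sumW (n + 1) f = sumW n f + f n := rfl
    rw [this, ih, Finset.sum_range_succ]

/-- Packed certificate: two graphs on `n` vertices given by pair classes `C`, the walk counts
`T` of the classes, vertex colours `E` at each level, and a linear recurrence. -/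
structure CertW where
  n : ℕ
  m : ℕ
  r : ℕ
  T : ℕ
  P : ℕ
  Q : ℕ
  C : Bool → ℕ
  E : ℕ → Bool → ℕ
  M : ℕ → ℕ
  Rep : ℕ → ℕ

namespace CertW

def t (D : CertW) (k a : ℕ) : ℕ := digW 16 D.T (32 * k + a)
def p (D : CertW) (k : ℕ) : ℕ := digW 8 D.P k
def q (D : CertW) (k : ℕ) : ℕ := digW 8 D.Q k
def c (D : CertW) (i : Bool) (x y : ℕ) : ℕ := digW 5 (D.C i) (D.n * x + y)
def e (D : CertW) (s : ℕ) (i : Bool) (x : ℕ) : ℕ := digW 6 (D.E s i) x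
def adj (D : CertW) (i : Bool) (x y : ℕ) : Bool := Nat.beq (D.t 1 (D.c i x y)) 1

def nbr (D : CertW) (s : ℕ) (i : Bool) (x : ℕ) : List (ℕ × ℕ) :=
  (List.range D.n).map fun y => (D.c i x y, D.e s i y)

def both (f : Bool → Bool) : Bool := f false && f true

def chkGraph (D : CertW) : Bool :=
  both fun i => allW D.n fun x => !(D.adj i x x) && allW D.n fun y => D.adj i x y == D.adj i y x

def chkZero (D : CertW) : Bool :=
  both fun i => allW D.n fun x => allW D.n fun y =>
    Nat.beq (D.t 0 (D.c i x y)) (bif Nat.beq x y then 1 else 0) && Nat.blt (D.c i x y) D.m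

def chkStep (D : CertW) : Bool :=
  allW 5 fun k => both fun i => allW D.n fun x => allW D.n fun y =>
    Nat.beq (D.t (k + 1) (D.c i x y))
      (sumW D.n fun z => bif D.adj i x z then D.t k (D.c i z y) else 0)

def chkRec (D : CertW) : Bool :=
  allW D.m fun a => Nat.beq (D.t 5 a + sumW 5 fun k => D.q k * D.t k a)
    (sumW 5 fun k => D.p k * D.t k a)

def chkInj (D : CertW) : Bool :=
  allW D.m fun a => allW D.m fun b => Nat.beq a b || !(allW 5 fun k => Nat.beq (D.t k a) (D.t k b))

def chkE0 (D : CertW) : Bool :=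
  both fun i => both fun j => allW D.n fun x => allW D.n fun y =>
    Nat.beq (D.e 0 i x) (D.e 0 j y) == Nat.beq (D.c i x x) (D.c j y y)

/-- Representative of colour `a` at level `s`: side and vertex. -/
def repI (D : CertW) (s a : ℕ) : Bool := Nat.testBit (digW 6 (D.Rep s) a) 0
def repX (D : CertW) (s a : ℕ) : ℕ := digW 6 (D.Rep s) a / 2

/-- The refinement data of two vertices at level `s` agree. -/
def same (D : CertW) (s : ℕ) (i j : Bool) (x y : ℕ) : Bool :=
  Nat.beq (D.e s i x) (D.e s j y) && (D.nbr s i x).isPerm (D.nbr s j y)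

/-- Every vertex agrees with the representative of its colour, and representatives of
different colours do not agree. -/
def chkE (D : CertW) : Bool :=
  allW (D.r + 1) fun s =>
    (both fun i => allW D.n fun x => Nat.blt (D.e (s + 1) i x) (D.M (s + 1)) &&
      D.same s i (D.repI (s + 1) (D.e (s + 1) i x)) x (D.repX (s + 1) (D.e (s + 1) i x))) &&
    allW (D.M (s + 1)) fun a => allW a fun b =>
      !(D.same s (D.repI (s + 1) a) (D.repI (s + 1) b) (D.repX (s + 1) a) (D.repX (s + 1) b))

def cols (D : CertW) (s : ℕ) (i : Bool) : List ℕ := (List.range D.n).map (D.e s i)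

def chkEnd (D : CertW) : Bool :=
  (D.cols D.r false).isPerm (D.cols D.r true) &&
    !((D.cols (D.r + 1) false).isPerm (D.cols (D.r + 1) true))

theorem both_iff (f : Bool → Bool) : both f = true ↔ ∀ i, f i = true := by
  simp [both]

theorem same_iff (D : CertW) (s : ℕ) (i j : Bool) (x y : ℕ) : D.same s i j x y = true ↔
    D.e s i x = D.e s j y ∧ (D.nbr s i x).Perm (D.nbr s j y) := by
  rw [same, Bool.and_eq_true, beqW_iff, List.isPerm_iff]

theorem same_symm (D : CertW) {s : ℕ} {i j : Bool} {x y : ℕ} (h : D.same s i j x y = true) :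
    D.same s j i y x = true := by
  rw [same_iff] at h ⊢
  exact ⟨h.1.symm, h.2.symm⟩

theorem same_trans (D : CertW) {s : ℕ} {i j k : Bool} {x y z : ℕ} (h : D.same s i j x y = true)
    (h' : D.same s j k y z = true) : D.same s i k x z = true := by
  rw [same_iff] at h h' ⊢
  exact ⟨h.1.trans h'.1, h.2.trans h'.2⟩

theorem chkE_iff (D : CertW) (h : D.chkE = true) (s : ℕ) (hs : s < D.r + 1) (i j : Bool)
    (x y : ℕ) (hx : x < D.n) (hy : y < D.n) :
    D.e (s + 1) i x = D.e (s + 1) j y ↔ D.same s i j x y = true := by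
  simp only [chkE, both_iff, allW_iff, Bool.and_eq_true, bltW_iff, Bool.not_eq_true'] at h
  obtain ⟨h1, h2⟩ := h s hs
  obtain ⟨mx, sx⟩ := h1 i x hx
  obtain ⟨my, sy⟩ := h1 j y hy
  constructor
  · intro hxy
    rw [← hxy] at sy
    exact D.same_trans sx (D.same_symm sy)
  · intro hxy
    have hr := D.same_trans (D.same_symm sx) (D.same_trans hxy sy)
    rcases lt_trichotomy (D.e (s + 1) i x) (D.e (s + 1) j y) with hlt | heq | hgt
    · have := h2 _ my _ hlt
      rw [D.same_symm hr] at this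
      simp at this
    · exact heq
    · have := h2 _ mx _ hgt
      rw [hr] at this
      simp at this

end CertW

open CertW

theorem map_eq_of_factors {I α β : Type*} (e : I → α) (w : I → β)
    (h : ∀ a b, e a = e b → w a = w b) (s t : Multiset I) (hst : s.map e = t.map e) :
    s.map w = t.map w := by
  rcases isEmpty_or_nonempty I with hI | hI
  · rw [Multiset.eq_zero_of_forall_notMem (s := s) (fun a => (hI.false a).elim),
      Multiset.eq_zero_of_forall_notMem (s := t) (fun a => (hI.false a).elim)]
  · obtain ⟨a0⟩ := hI
    have : Nonempty β := ⟨w a0⟩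
    have hf : Function.FactorsThrough w e := fun a b hab => h a b hab
    obtain ⟨F, hF⟩ := (Function.factorsThrough_iff w).1 hf
    rw [hF, ← Multiset.map_map, hst, Multiset.map_map]

theorem map_eq_iff {I α β : Type*} (e : I → α) (w : I → β)
    (h : ∀ a b, e a = e b ↔ w a = w b) (s t : Multiset I) :
    s.map e = t.map e ↔ s.map w = t.map w :=
  ⟨map_eq_of_factors e w (fun a b => (h a b).1) s t,
    map_eq_of_factors w e (fun a b => (h a b).2) s t⟩

theorem seq_eq_of_rec (f g : ℕ → ℕ) (p q : ℕ → ℕ)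
    (hf : ∀ k, f (k + 5) + ∑ i ∈ Finset.range 5, q i * f (k + i)
      = ∑ i ∈ Finset.range 5, p i * f (k + i))
    (hg : ∀ k, g (k + 5) + ∑ i ∈ Finset.range 5, q i * g (k + i)
      = ∑ i ∈ Finset.range 5, p i * g (k + i))
    (h : ∀ k < 5, f k = g k) : f = g := by
  funext k
  induction k using Nat.strong_induction_on with
  | _ k ih =>
    by_cases hk : k < 5
    · exact h k hk
    · obtain ⟨l, rfl⟩ : ∃ l, k = l + 5 := ⟨k - 5, by omega⟩
      have h1 := hf l
      have h2 := hg l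
      have e1 : ∀ i ∈ Finset.range 5, f (l + i) = g (l + i) := fun i hi =>
        ih _ (by have := Finset.mem_range.1 hi; omega)
      rw [Finset.sum_congr rfl (fun i hi => by rw [e1 i hi] :
          ∀ i ∈ Finset.range 5, q i * f (l + i) = q i * g (l + i)),
        Finset.sum_congr rfl (fun i hi => by rw [e1 i hi] :
          ∀ i ∈ Finset.range 5, p i * f (l + i) = p i * g (l + i))] at h1
      omega

theorem univ_map_eq {α : Type*} (n : ℕ) (f : ℕ → α) :
    (Finset.univ : Finset (Fin n)).val.map (fun x : Fin n => f x) = ((List.range n).map f : List α) := by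
  have : (Finset.univ : Finset (Fin n)).val = ((List.finRange n : List (Fin n)) : Multiset _) := rfl
  rw [this, Multiset.map_coe, ← List.map_coe_finRange_eq_range, List.map_map]
  rfl

/-- The graph described by the certificate. -/
def CertW.graph (D : CertW) (h : D.chkGraph = true) (i : Bool) : SimpleGraph (Fin D.n) where
  Adj x y := D.adj i x y = true
  symm := ⟨by
    intro x y hxy
    simp only [chkGraph, both_iff, allW_iff, Bool.and_eq_true, beq_iff_eq] at h
    rw [← ((h i x x.2).2 y y.2)]; exact hxy⟩
  loopless := ⟨by
    intro x hx
    simp only [chkGraph, both_iff, allW_iff, Bool.and_eq_true, beq_iff_eq] at h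
    have := (h i x x.2).1
    simp [hx] at this⟩

instance CertW.graphDec (D : CertW) (h : D.chkGraph = true) (i : Bool) :
    DecidableRel (D.graph h i).Adj := fun x y =>
  inferInstanceAs (Decidable (D.adj i x y = true))

theorem CertW.pow_eq (D : CertW) (h : D.chkGraph = true) (h0 : D.chkZero = true)
    (hs : D.chkStep = true) (i : Bool) (k : ℕ) (hk : k ≤ 5) (x y : Fin D.n) :
    ((D.graph h i).adjMatrix ℕ ^ k) x y = D.t k (D.c i x y) := by
  induction k generalizing x y with
  | zero =>
    simp only [chkZero, both_iff, allW_iff, Bool.and_eq_true, beqW_iff] at h0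
    have := (h0 i x x.2 y y.2).1
    rw [this, pow_zero, Matrix.one_apply]
    by_cases hxy : x = y
    · simp [hxy]
    · have : Nat.beq (x : ℕ) y = false := by
        rw [Bool.eq_false_iff]; intro hh
        exact hxy (Fin.ext (Nat.eq_of_beq_eq_true hh))
      simp [hxy, this]
  | succ k ih =>
    simp only [chkStep, both_iff, allW_iff, beqW_iff] at hs
    rw [hs k (by omega) i x x.2 y y.2, sumW_eq, pow_succ', Matrix.mul_apply, Finset.sum_range]
    refine Finset.sum_congr rfl fun z _ => ?_
    rw [ih (by omega), SimpleGraph.adjMatrix_apply]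
    by_cases hz : D.adj i x z = true
    · have : (D.graph h i).Adj x z := hz
      simp [this, hz]
    · have h' : ¬ (D.graph h i).Adj x z := hz
      simp [h', hz]

theorem CertW.walk_rec (D : CertW) (h : D.chkGraph = true) (h0 : D.chkZero = true)
    (hs : D.chkStep = true) (hr : D.chkRec = true) (i : Bool) (x y : Fin D.n) (k : ℕ) :
    walkFun (D.graph h i) x y (k + 5)
        + ∑ l ∈ Finset.range 5, D.q l * walkFun (D.graph h i) x y (k + l)
      = ∑ l ∈ Finset.range 5, D.p l * walkFun (D.graph h i) x y (k + l) := by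
  have key : (D.graph h i).adjMatrix ℕ ^ 5
      + ∑ l ∈ Finset.range 5, D.q l • (D.graph h i).adjMatrix ℕ ^ l
      = ∑ l ∈ Finset.range 5, D.p l • (D.graph h i).adjMatrix ℕ ^ l := by
    ext x y
    simp only [chkZero, both_iff, allW_iff, Bool.and_eq_true, bltW_iff] at h0
    have hm := (h0 i x x.2 y y.2).2
    simp only [chkRec, allW_iff, beqW_iff, sumW_eq] at hr
    have h0' : D.chkZero = true := by
      simpa only [chkZero, both_iff, allW_iff, Bool.and_eq_true, bltW_iff] using h0
    have := hr _ hm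
    rw [Matrix.add_apply, Matrix.sum_apply, Matrix.sum_apply, D.pow_eq h h0' hs i 5 le_rfl]
    have e1 : ∀ l ∈ Finset.range 5, ∀ a : ℕ, (a • (D.graph h i).adjMatrix ℕ ^ l) x y
        = a * D.t l (D.c i x y) := fun l hl a => by
      rw [Matrix.smul_apply, D.pow_eq h h0' hs i l (by have := Finset.mem_range.1 hl; omega),
        smul_eq_mul]
    rw [Finset.sum_congr rfl fun l hl => e1 l hl _, Finset.sum_congr rfl fun l hl => e1 l hl _]
    exact this
  have key2 := congrArg (fun M => ((D.graph h i).adjMatrix ℕ ^ k * M) x y) key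
  simp only [mul_add, Finset.mul_sum, mul_smul_comm, ← pow_add, Matrix.add_apply,
    Matrix.sum_apply, Matrix.smul_apply, smul_eq_mul] at key2
  exact key2

theorem CertW.walk_iff (D : CertW) (h : D.chkGraph = true) (h0 : D.chkZero = true)
    (hs : D.chkStep = true) (hr : D.chkRec = true) (hi : D.chkInj = true)
    (i j : Bool) (x y x' y' : Fin D.n) :
    D.c i x y = D.c j x' y' ↔ walkFun (D.graph h i) x y = walkFun (D.graph h j) x' y' := by
  constructor
  · intro hc
    refine seq_eq_of_rec _ _ D.p D.q (D.walk_rec h h0 hs hr i x y)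
      (D.walk_rec h h0 hs hr j x' y') fun k hk => ?_
    rw [walkFun, walkFun, D.pow_eq h h0 hs i k hk.le, D.pow_eq h h0 hs j k hk.le, hc]
  · intro hw
    have hw' : ∀ k < 5, D.t k (D.c i x y) = D.t k (D.c j x' y') := fun k hk => by
      rw [← D.pow_eq h h0 hs i k hk.le, ← D.pow_eq h h0 hs j k hk.le]
      exact congrFun hw k
    simp only [chkZero, both_iff, allW_iff, Bool.and_eq_true, bltW_iff] at h0
    simp only [chkInj, allW_iff, Bool.or_eq_true, beqW_iff, Bool.not_eq_true',
      Bool.eq_false_iff, ne_eq] at hi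
    rcases hi _ (h0 i x x.2 y y.2).2 _ (h0 j x' x'.2 y' y'.2).2 with h1 | h1
    · exact h1
    · exact (h1 hw').elim

theorem CertW.omega_iff (D : CertW) (h : D.chkGraph = true) (h0 : D.chkZero = true)
    (hs : D.chkStep = true) (hr : D.chkRec = true) (hi : D.chkInj = true)
    (he0 : D.chkE0 = true) (he : D.chkE = true) (s : ℕ) (hsr : s ≤ D.r + 1)
    (a b : Bool × Fin D.n) :
    D.e s a.1 a.2 = D.e s b.1 b.2 ↔
      omegaC (D.graph h a.1) s a.2 = omegaC (D.graph h b.1) s b.2 := by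
  induction s generalizing a b with
  | zero =>
    simp only [chkE0, both_iff, allW_iff, beq_iff_eq] at he0
    have := he0 a.1 b.1 a.2 a.2.2 b.2 b.2.2
    rw [Bool.eq_iff_iff, beqW_iff, beqW_iff] at this
    rw [this]
    exact D.walk_iff h h0 hs hr hi a.1 b.1 a.2 a.2 b.2 b.2
  | succ s ih =>
    have h1 := D.chkE_iff he s (by omega) a.1 b.1 a.2 b.2 a.2.2 b.2.2
    rw [same_iff, ← Multiset.coe_eq_coe] at h1
    rw [h1, ih (by omega) a b]
    unfold nbr
    rw [← univ_map_eq D.n (fun y => (D.c a.1 a.2 y, D.e s a.1 y)),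
      ← univ_map_eq D.n (fun y => (D.c b.1 b.2 y, D.e s b.1 y))]
    have h2 := map_eq_iff
      (fun u : (Bool × Fin D.n) × Fin D.n => (D.c u.1.1 u.1.2 u.2, D.e s u.1.1 u.2))
      (fun u : (Bool × Fin D.n) × Fin D.n =>
        (walkFun (D.graph h u.1.1) u.1.2 u.2, omegaC (D.graph h u.1.1) s u.2))
      (fun u v => by
        rw [Prod.mk.injEq, Prod.mk.injEq, D.walk_iff h h0 hs hr hi,
          ih (by omega) (u.1.1, u.2) (v.1.1, v.2)])
      ((Finset.univ : Finset (Fin D.n)).val.map fun y => (a, y))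
      ((Finset.univ : Finset (Fin D.n)).val.map fun y => (b, y))
    simp only [Multiset.map_map, Function.comp_def] at h2
    rw [h2]
    exact Prod.mk.injEq .. |>.symm ▸ Iff.rfl

theorem CertW.wR_iff (D : CertW) (h : D.chkGraph = true) (h0 : D.chkZero = true)
    (hs : D.chkStep = true) (hr : D.chkRec = true) (hi : D.chkInj = true)
    (he0 : D.chkE0 = true) (he : D.chkE = true) (s : ℕ) (hsr : s ≤ D.r + 1) :
    (D.cols s false).isPerm (D.cols s true) = true ↔
      wR (D.graph h false) s = wR (D.graph h true) s := by
  rw [List.isPerm_iff, ← Multiset.coe_eq_coe]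
  unfold cols
  rw [← univ_map_eq D.n (D.e s false), ← univ_map_eq D.n (D.e s true)]
  have h2 := map_eq_iff
    (fun u : Bool × Fin D.n => D.e s u.1 u.2)
    (fun u : Bool × Fin D.n => omegaC (D.graph h u.1) s u.2)
    (fun u v => D.omega_iff h h0 hs hr hi he0 he s hsr u v)
    ((Finset.univ : Finset (Fin D.n)).val.map fun y => (false, y))
    ((Finset.univ : Finset (Fin D.n)).val.map fun y => (true, y))
  simp only [Multiset.map_map, Function.comp_def] at h2
  exact h2

theorem CertW.conclude (D : CertW) (h : D.chkGraph = true) (h0 : D.chkZero = true)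
    (hs : D.chkStep = true) (hr : D.chkRec = true) (hi : D.chkInj = true)
    (he0 : D.chkE0 = true) (he : D.chkE = true) (hend : D.chkEnd = true)
    (r : ℕ) (hD : D.r = r) :
    ∃ (n m : ℕ) (G : SimpleGraph (Fin n)) (H : SimpleGraph (Fin m))
        (dG : DecidableRel G.Adj) (dH : DecidableRel H.Adj),
        @wR (Fin n) _ _ G dG r = @wR (Fin m) _ _ H dH r ∧
          @wR (Fin n) _ _ G dG (r + 1) ≠ @wR (Fin m) _ _ H dH (r + 1) := by
  subst hD
  simp only [chkEnd, Bool.and_eq_true, Bool.not_eq_true', Bool.eq_false_iff, ne_eq] at hend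
  refine ⟨D.n, D.n, D.graph h false, D.graph h true, inferInstance, inferInstance, ?_, ?_⟩
  · exact (D.wR_iff h h0 hs hr hi he0 he D.r (by omega)).1 hend.1
  · exact fun hw => hend.2 ((D.wR_iff h h0 hs hr hi he0 he (D.r + 1) le_rfl).2 hw)

/-- Certificate for `r = 1`. -/
def cert1W : CertW where
  n := 23
  m := 17
  r := 1
  T := 303449383420934653461979836910739993011349378508255788884194936949545693064836016045864040162078189833352807150968414163219819601184906265133255860479489272274936637115480749192698849290248055515216724520974395213597843782137440270373775814504750640177557410630369769557285044533526020358213712694714066371378983863406478004969365252026311598620356426739991550355667251876091471610179728636414687252079162912723917487237613805589901537891329122635373560454333464878865716900363538729709125460521964408646615307728127839069828522272501689601311931897549937114565579609616314594077342769004760486853406116090557565930387970202475780864493045202934895499525747047489603348818293758479697044198637945414851916956334160188320032248456288688565906577438852990774765065470759031561729424647905444053641785901829850933866174878771669364571997016794248039628801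
  P := 39124467712
  Q := 3164160
  C i := bif i then
    49685869115091121425721678502724589465058452926611709486884591013886551230186406781706954349677910607711365100600823800922837589499680533830797598153990845396602719755843617676264948908294233401170699987388892868480138506307400092324960887959449849946344563619964868833338764853205017498357639578346391111694974317875648969052926520138357360291412358543231174814791738659246275819419688673244987083586519013610927839785415070130489953770483239181471118753795299775580660002699406036752745456196760391636695816701431694241293309631367039532367501304148710990450041234078313955802787782764367140628355512506942764466976280619879233990961434625779281421513590326633793521306211686985583308119536107527832816786492897907045471170777174516235177194984719429803036286181584234876935938940467947945454
    else
    34850496318556340669080204079486649687340132946600605595577637871432422112264294535323385383379405891986014783579791022685923932431863254015929918591982295244070879173049565352591979016831619309832200529060380051990769281629695242600783393193409455685309137326397708234331644290437629068747733369083138767646960853074567942530375622087281965849981631916384810356467469400232483328631704803890961641560580654830451594602706341664693196544959417341008667774198739893731007628836862499557861266149034821183518728835199906329063268387878433801651336078906084474939155088403550806248874146045019248637288992340006574809010725654751076408923638048229213898879266941653266504420649688135438913259873045228520548698145470688890093363220770857377877147433924721766477154824323976448923362106040055334944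
  E s i := match s with
    | 0 => bif i then 1329233145616083836782538649216491650 else 170141832497576860262499965598712209472
    | 1 => bif i then 1329248598880529369890736790821412994 else 16758908208660854067254706346118689333312
    | _ => bif i then 27224022448211128931067173596690241061000 else 16929153887491742124963739531982070882368
  M s := match s with
    | 0 => 3
    | 1 => 6
    | _ => 11
  Rep s := match s with
    | 0 => 16512
    | 1 => 38790512768
    | _ => 17492421730304016512

/-- Certificate for `r = 2`. -/
def cert2W : CertW where
  n := 23
  m := 17
  r := 2
  T := 306208841828106698040362548920858530346477271854285092634546787754590310460529197783572291118429116891188146943942857193737191071820551356276405902906766011143345196194387383438837890121730586485322449202297141757494650444062499966403798384103768815498708612755086327909153330642081456037406858193852948736760478250591268886522929105610993313281276646330682528301958042332327270652814767448743602687224719870158456268642727112367911489570380597613296581060015338796627387154137071085862875987434111380105260798226517722175032924091860462094684669302513550611012780358308061174908458722814512752061987446868149649696452114215690734256756440716321669904974858191975033768015761786117439417941098989810203151081947460306636862441217181349687557539144844101690920881179566834203151660010123063318024072010535889753960099777037160238690145899768342034513921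
  P := 39124467712
  Q := 3164160
  C i := bif i then
    3689942868150597371758758892612884261651650437931867601860299545519187710111068747774275083640603904602673084953053627600920524287885097209976049847204756162380537533158767894678782228092216524944589037748609568535459034653545996098931637328982348975907816784118621091312587380234215686372764942806821767076386745338439323273020076803074651029108562342056509895218335029893691552589170356616971462282283885947660563495730504251477080038177584694366406571865139583726715381498275755680758222592775683286997954197035428485656513464121918351470182239625239887251596666875223662127191335330328095835997470973753076532188005331434724352456513246074681265665225052133219889956364324022171384789887020915013931239428930839308185031569767577341449597192628408497530018906641036149883310731251516863456679
    else
    7603934460739490073910800433669486185659494533665639962792936933474569841051264023135087270056259149853041888631970869363899068568774839647703300942823019537941666922376919746908777156172194714400556796269250735921186729797725456197650065361470791787698211149996000322240824101645997947754087096357581410123343123405677560397116762096187092954446625076618898700495661085301996519757917105462747460073142206248580897352716308723093227848760172322115934304009166581941345881891556303845089390630836946446489524758075596635048092515387578097117613348688952884257746345844196343254795133457254787239885190079026727099573104400817122134429071309821852537298045102154134888620049121824980360829253002089070911094777038328452198700909608712412628101421090387689051555197978256955130577980962864215655456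
  E s i := match s with
    | 0 => bif i then 5447197095995723736091948152291376500865 else 11061877243816749416512049980324641509440
    | 1 => bif i then 5451226967398807189394476872042339897603 else 27654672512913966860377726572480021401664
    | 2 => bif i then 10897095159916081070740271177656072151364 else 33270681893962312067414304687073798922304
    | _ => bif i then 43564202384801542567234316511227848982852 else 33270681893962312067414304687073798922304
  M s := match s with
    | 0 => 3
    | 1 => 6
    | 2 => 8
    | _ => 10
  Rep s := match s with
    | 0 => 65664
    | 1 => 43221819520
    | 2 => 187484149923968
    | _ => 127695648599851136

/-- Certificate for `r = 3`. -/
def cert3W : CertW where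
  n := 24
  m := 17
  r := 3
  T := 924296299663394732331435268215868267760474588764649799532736883450874543564721314845385181889330947997256372325483747482766936169322103337386440467292080118359289775416720234649599135142616480205086503892277978960470091431799279425012724212835912198532962679108318300460580363840819037599203047421853502880360833437905025317325053485140661709097289600702812727275917557758361204464586859761260584604972723409907643946546757523977513154330881383758685996056817199047943662044394861041496278458376919568349248049792161633462236533633261523223146058117471926545957458099381424116001369558549448359674630776856554039927672189916421174650305661445385242100290587122341302928688037406140511457553019529372579786776415320255092526728741988689892314623136095506355882937781666803904653719130064194219175150904057211653844926949361421844603114745862566753337345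
  P := 52042924050
  Q := 4605184
  C i := bif i then
    1074350035143250859090829608391279256601331461198374784611313195805510847415313871358329841800328381718483871866938332518756957310275104229674711990963055181905454639209854748408881010736102461288670176356718919135105365373553387983432091413074869632335320851013792611580070975914060679740771910304557513661999378436878310004084328679036064694807440515273321606534813767714980084027470509305085027447116061503301918848341709039544671225249136259185564191582085956949926006128618993227067736424911891774373821695397560330038252198382476030780143471028129342976225932995032671557247463150041062432946668730203314501387116244726678854645328197470773561871504306505091774425582409148046431600734325962680008013620986165623459452211535691868680327344776366428485379745396957099339680045504347164807650532917734329862377532515435631137192504105467345527851596340286032960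
    else
    407177995009057196129900710111871342173898230648693956635689977839701840073687194802146037566435772572938039864925678807382411312125815873197989695265737491803817758029528064928173657850610832539686493104657723133601098376400365772933800441937162351330234608504529454256510542137057451583515122468712869787093805725218274166094755518614729889589528060976132276750271179876740219155025065027348872207854306555455482619938155126820228414519599516653871827180543232229139732860622851721835228851251040165552619409746140447905217096938227673461057415935938174727964071042627195025748293135535134271339092608724622206236635492310083730385464521088440076671609696674698991905618907346019584126712778781900196383203668927344743166471895580451031587086862231627030119743748128005653951920286490188827913691118602702798501951056430948527067308132237897394163269931924111591456
  E s i := match s with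
    | 0 => bif i then 5445847757911627015818559257411862921344 else 697068428647844580016121033903487578021952
    | 1 => bif i then 1399242422681604352452183355569785558548804 else 1742421261130990152578787525129078015270976
    | 2 => bif i then 1399242422691904052264811557106604064408133 else 3136223173730468354032978744059937595334720
    | 3 => bif i then 1426465240521945576922881941157828640412549 else 4939295694686653633754017208806975748448320
    | _ => bif i then 1509689663399908174761917965607386624594821 else 4939295694686653633754017208806975748448320
  M s := match s with
    | 0 => 3
    | 1 => 6
    | 2 => 10
    | 3 => 15
    | _ => 22
  Rep s := match s with
    | 0 => 16512
    | 1 => 21678801024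
    | 2 => 835506943994380416
    | 3 => 902616336519123226159759488
    | _ => 3883327041311039942885691075687187234944

theorem cert1W_Graph : cert1W.chkGraph = true := by decide +kernel

theorem cert1W_Zero : cert1W.chkZero = true := by decide +kernel

theorem cert1W_Step : cert1W.chkStep = true := by decide +kernel

theorem cert1W_Rec : cert1W.chkRec = true := by decide +kernel

theorem cert1W_Inj : cert1W.chkInj = true := by decide +kernel

theorem cert1W_E0 : cert1W.chkE0 = true := by decide +kernel

theorem cert1W_E : cert1W.chkE = true := by decide +kernel

theorem cert1W_End : cert1W.chkEnd = true := by decide +kernel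

theorem cert2W_Graph : cert2W.chkGraph = true := by decide +kernel

theorem cert2W_Zero : cert2W.chkZero = true := by decide +kernel

theorem cert2W_Step : cert2W.chkStep = true := by decide +kernel

theorem cert2W_Rec : cert2W.chkRec = true := by decide +kernel

theorem cert2W_Inj : cert2W.chkInj = true := by decide +kernel

theorem cert2W_E0 : cert2W.chkE0 = true := by decide +kernel

theorem cert2W_E : cert2W.chkE = true := by decide +kernel

theorem cert2W_End : cert2W.chkEnd = true := by decide +kernel

theorem cert3W_Graph : cert3W.chkGraph = true := by decide +kernel

theorem cert3W_Zero : cert3W.chkZero = true := by decide +kernel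

theorem cert3W_Step : cert3W.chkStep = true := by decide +kernel

theorem cert3W_Rec : cert3W.chkRec = true := by decide +kernel

theorem cert3W_Inj : cert3W.chkInj = true := by decide +kernel

theorem cert3W_E0 : cert3W.chkE0 = true := by decide +kernel

theorem cert3W_E : cert3W.chkE = true := by decide +kernel

theorem cert3W_End : cert3W.chkEnd = true := by decide +kernel

/-- For each `r ∈ {1, 2, 3}` there exist finite simple graphs with
`w⁽ʳ⁾(G) = w⁽ʳ⁾(H)` but `w⁽ʳ⁺¹⁾(G) ≠ w⁽ʳ⁺¹⁾(H)`: the hierarchy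
`w⁽¹⁾ ⪯ w⁽²⁾ ⪯ w⁽³⁾ ⪯ w⁽⁴⁾` is strict. -/
theorem wR_hierarchy_strict_up_to_four :
    ∀ r ∈ ({1, 2, 3} : Finset ℕ),
      ∃ (n m : ℕ) (G : SimpleGraph (Fin n)) (H : SimpleGraph (Fin m))
        (dG : DecidableRel G.Adj) (dH : DecidableRel H.Adj),
        @wR (Fin n) _ _ G dG r = @wR (Fin m) _ _ H dH r ∧
          @wR (Fin n) _ _ G dG (r + 1) ≠ @wR (Fin m) _ _ H dH (r + 1) := by
  intro r hr
  simp only [Finset.mem_insert, Finset.mem_singleton] at hr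
  rcases hr with rfl | rfl | rfl
  · exact cert1W.conclude cert1W_Graph cert1W_Zero cert1W_Step cert1W_Rec
      cert1W_Inj cert1W_E0 cert1W_E cert1W_End 1 rfl
  · exact cert2W.conclude cert2W_Graph cert2W_Zero cert2W_Step cert2W_Rec
      cert2W_Inj cert2W_E0 cert2W_E cert2W_End 2 rfl
  · exact cert3W.conclude cert3W_Graph cert3W_Zero cert3W_Step cert3W_Rec
      cert3W_Inj cert3W_E0 cert3W_E cert3W_End 3 rfl
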